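/- arXiv:1410.8838 — 2 statements merged into one kernel-verified Lean document; each statement's English description precedes it below -/
import Mathlib

section
/- With the matrices wₙ, wₙ* ∈ Mₙ(F) of the construction: for all integers i, j > 0 one has (1 − wₙ^i(wₙ*)^i)(1 − (wₙ*)^j wₙ^j) = 0 and (1 − (wₙ*)^j wₙ^j)(1 − wₙ^i(wₙ*)^i) = 0 for all sufficiently large n. -/
open Polynomial

namespace SkewConstruction

/-- the lower shift matrix `wₙ = ∑_{i=1}^{n-1} e_{i+1,i}` of size `n` (`w₁ = 0`). -/
def wmat (F : Type*) [Field F] (n : ℕ) : Matrix (Fin n) (Fin n) F :=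
  Matrix.of fun (a b : Fin n) => if (a : ℕ) = (b : ℕ) + 1 then (1 : F) else 0

/-- `F_k = f₀ f₁ ⋯ f_k`. -/
noncomputable def Fk {F : Type*} [Field F] (f : ℕ → F[X]) (k : ℕ) : F[X] :=
  ∏ m ∈ Finset.range (k + 1), f m

/-- `N(k)`, the degree of `F_k`. -/
noncomputable def Nk {F : Type*} [Field F] (f : ℕ → F[X]) (k : ℕ) : ℕ :=
  (Fk f k).natDegree

/-- for `n ≥ M 1`, the unique `k ≥ 1` with `M k ≤ n < M (k+1)`. -/
def kidx (M : ℕ → ℕ) (n : ℕ) : ℕ :=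
  Nat.findGreatest (fun k => M k ≤ n) n

/-- the matrix `wₙ*` of the construction: for `n < M(1)` it is the upper shift
`∑_{i=1}^{n-1} e_{i,i+1}`; for `M(k) ≤ n < M(k+1)` (`k ≥ 1`) one subtracts
`∑_{j=1}^{N(k)} a_{k,j} (e_{j,1} + e_{n,n-j+1})`, where `a_{k,j}` is the `j`-th
coefficient of `F_k` (written here via `Polynomial.coeff`, which vanishes beyond the
degree `N(k)`). -/
noncomputable def wstarmat {F : Type*} [Field F] (f : ℕ → F[X]) (M : ℕ → ℕ) (n : ℕ) :
    Matrix (Fin n) (Fin n) F :=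
  (Matrix.of fun (a b : Fin n) => if (b : ℕ) = (a : ℕ) + 1 then (1 : F) else 0) -
    (if M 1 ≤ n then
      (Matrix.of fun (a b : Fin n) =>
        (if (b : ℕ) = 0 then (Fk f (kidx M n)).coeff ((a : ℕ) + 1) else 0) +
        (if (a : ℕ) = n - 1 then (Fk f (kidx M n)).coeff (n - (b : ℕ)) else 0))
    else 0)

end SkewConstruction

namespace SkewConstruction

/-- The upper shift of size `n`, with its first column and last row corrected by the
coefficients of `p`. -/
noncomputable def correctedShift {F : Type*} [Field F] (p : F[X]) (n : ℕ) :
    Matrix (Fin n) (Fin n) F :=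
  Matrix.of fun a b => (if (b : ℕ) = (a : ℕ) + 1 then (1 : F) else 0) -
    ((if (b : ℕ) = 0 then p.coeff ((a : ℕ) + 1) else 0) +
      (if (a : ℕ) = n - 1 then p.coeff (n - (b : ℕ)) else 0))

theorem one_sub_pow_mul_pow {R : Type*} [Ring R] (a b : R) (i : ℕ) :
    1 - a ^ i * b ^ i = ∑ l ∈ Finset.range i, a ^ l * (1 - a * b) * b ^ l := by
  induction i with
  | zero => simp
  | succ i ih =>
    rw [Finset.sum_range_succ, ← ih, pow_succ a, pow_succ' b]
    noncomm_ring

theorem one_sub_pow_mul_pow_mul_eq_zero {R : Type*} [Ring R] {a b : R} {i j : ℕ}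
    (h : ∀ s < i + j, (1 - a * b) * b ^ s * (1 - b * a) = 0) :
    (1 - a ^ i * b ^ i) * (1 - b ^ j * a ^ j) = 0 := by
  rw [one_sub_pow_mul_pow, one_sub_pow_mul_pow, Finset.sum_mul_sum]
  refine Finset.sum_eq_zero fun l hl => Finset.sum_eq_zero fun m hm => ?_
  rw [Finset.mem_range] at hl hm
  calc a ^ l * (1 - a * b) * b ^ l * (b ^ m * (1 - b * a) * a ^ m)
      = a ^ l * ((1 - a * b) * b ^ (l + m) * (1 - b * a)) * a ^ m := by
        rw [pow_add]; simp only [mul_assoc]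
    _ = 0 := by rw [h (l + m) (by omega)]; simp

section

variable {F : Type*} [Field F] {n : ℕ}

theorem one_sub_wmat_mul_correctedShift_apply {p : F[X]} (hp : p.coeff 0 = 1) (a b : Fin n) :
    (1 - wmat F n * correctedShift p n) a b = if (b : ℕ) = 0 then p.coeff a else 0 := by
  rw [Matrix.sub_apply, Matrix.mul_apply, Matrix.one_apply]
  rcases Nat.eq_zero_or_pos (a : ℕ) with ha | ha
  · rw [Finset.sum_eq_zero fun c _ => by simp [wmat, ha]]
    simp [Fin.ext_iff, ha, hp, eq_comm]
  · rw [Finset.sum_eq_single (⟨a - 1, by omega⟩ : Fin n)]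
    · have h1 : (a : ℕ) - 1 + 1 = a := by omega
      have h2 : (a : ℕ) - 1 ≠ n - 1 := by omega
      simp [wmat, correctedShift, h1, h2, Fin.ext_iff, eq_comm (a := (b : ℕ)) (b := (a : ℕ))]
    · intro c _ hc
      have : (a : ℕ) ≠ c + 1 := fun h => hc (Fin.ext (by simp [h]))
      simp [wmat, this]
    · simp

theorem one_sub_correctedShift_mul_wmat_apply {p : F[X]} (hp : p.coeff 0 = 1) (a b : Fin n) :
    (1 - correctedShift p n * wmat F n) a b =
      if (a : ℕ) = n - 1 then p.coeff (n - 1 - b) else 0 := by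
  rw [Matrix.sub_apply, Matrix.mul_apply, Matrix.one_apply]
  by_cases hb : (b : ℕ) = n - 1
  · rw [Finset.sum_eq_zero fun c _ => by
      have : (c : ℕ) ≠ b + 1 := by omega
      simp [wmat, this]]
    simp [Fin.ext_iff, hb, hp]
  · rw [Finset.sum_eq_single (⟨b + 1, by omega⟩ : Fin n)]
    · have h1 : n - ((b : ℕ) + 1) = n - 1 - b := by omega
      simp [wmat, correctedShift, h1, Fin.ext_iff, eq_comm (a := (b : ℕ)) (b := (a : ℕ))]
    · intro c _ hc
      have : (c : ℕ) ≠ b + 1 := fun h => hc (Fin.ext h)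
      simp [wmat, this]
    · simp

theorem wmat_pow_apply_eq_zero {s : ℕ} {a b : Fin n} (h : (a : ℕ) ≠ b + s) :
    (wmat F n ^ s) a b = 0 := by
  induction s generalizing a b with
  | zero => exact Matrix.one_apply_ne fun e => h (by simp [e])
  | succ s ih =>
    rw [pow_succ, Matrix.mul_apply]
    refine Finset.sum_eq_zero fun c _ => ?_
    by_cases hc : (c : ℕ) = b + 1
    · rw [ih (by omega), zero_mul]
    · simp [wmat, hc]

theorem correctedShift_pow_apply_eq_zero {p : F[X]} {s : ℕ} {a b : Fin n} (h : (a : ℕ) + s < b) :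
    (correctedShift p n ^ s) a b = 0 := by
  induction s generalizing a b with
  | zero => exact Matrix.one_apply_ne fun e => by simp [e] at h
  | succ s ih =>
    rw [pow_succ, Matrix.mul_apply]
    refine Finset.sum_eq_zero fun c _ => ?_
    by_cases hc : (a : ℕ) + s < c
    · rw [ih hc, zero_mul]
    · have h1 : (b : ℕ) ≠ c + 1 := by omega
      have h2 : (b : ℕ) ≠ 0 := by omega
      have h3 : (c : ℕ) ≠ n - 1 := by omega
      simp only [correctedShift, Matrix.of_apply, if_neg h1, if_neg h2, if_neg h3]
      simp

theorem one_sub_mul_correctedShift_pow_mul_one_sub {p : F[X]} (hp : p.coeff 0 = 1) {s : ℕ}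
    (hs : s + 1 < n) :
    (1 - wmat F n * correctedShift p n) * correctedShift p n ^ s *
      (1 - correctedShift p n * wmat F n) = 0 := by
  ext a b
  rw [Matrix.mul_apply]
  refine Finset.sum_eq_zero fun d _ => ?_
  rw [one_sub_correctedShift_mul_wmat_apply hp]
  split_ifs with hd
  · rw [Matrix.mul_apply, Finset.sum_eq_zero, zero_mul]
    intro c _
    rw [one_sub_wmat_mul_correctedShift_apply hp]
    split_ifs with hc
    · rw [correctedShift_pow_apply_eq_zero (by omega), mul_zero]
    · rw [zero_mul]
  · rw [mul_zero]

theorem one_sub_mul_wmat_pow_mul_one_sub {p : F[X]} (hp : p.coeff 0 = 1) {s : ℕ}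
    (hs : 2 * p.natDegree + s + 1 < n) :
    (1 - correctedShift p n * wmat F n) * wmat F n ^ s *
      (1 - wmat F n * correctedShift p n) = 0 := by
  ext a b
  rw [Matrix.mul_apply]
  refine Finset.sum_eq_zero fun d _ => ?_
  rw [one_sub_wmat_mul_correctedShift_apply hp]
  by_cases hd : p.natDegree < d
  · simp [coeff_eq_zero_of_natDegree_lt hd]
  · rw [Matrix.mul_apply, Finset.sum_eq_zero, zero_mul]
    intro c _
    by_cases hc : (c : ℕ) = d + s
    · rw [one_sub_correctedShift_mul_wmat_apply hp,
        coeff_eq_zero_of_natDegree_lt (by omega : p.natDegree < n - 1 - c)]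
      simp
    · rw [wmat_pow_apply_eq_zero hc, mul_zero]

theorem wstarmat_eq_correctedShift (f : ℕ → F[X]) {M : ℕ → ℕ} (h : M 1 ≤ n) :
    wstarmat f M n = correctedShift (Fk f (kidx M n)) n := by
  ext a b
  simp [wstarmat, correctedShift, h]

theorem Fk_coeff_zero {f : ℕ → F[X]} (hf : ∀ m, (f m).coeff 0 = 1) (k : ℕ) :
    (Fk f k).coeff 0 = 1 := by
  rw [Fk, coeff_zero_eq_eval_zero, eval_prod]
  exact Finset.prod_eq_one fun m _ => by rw [← coeff_zero_eq_eval_zero, hf]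

theorem four_mul_natDegree_Fk_kidx_le {f : ℕ → F[X]} {M : ℕ → ℕ} (hM1 : 1 ≤ M 1)
    (hMN : ∀ k : ℕ, 1 ≤ k → 2 * (k + 1) * Nk f k ≤ M k) (hn : M 1 ≤ n) :
    4 * (Fk f (kidx M n)).natDegree ≤ n := by
  have hk : 1 ≤ kidx M n := Nat.le_findGreatest (hM1.trans hn) hn
  have hMk : M (kidx M n) ≤ n :=
    Nat.findGreatest_spec (P := fun k => M k ≤ n) (hM1.trans hn) hn
  calc 4 * (Fk f (kidx M n)).natDegree ≤ 2 * (kidx M n + 1) * Nk f (kidx M n) :=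
        Nat.mul_le_mul_right _ (by omega)
    _ ≤ n := (hMN _ hk).trans hMk

end

end SkewConstruction

open SkewConstruction in
/-- Corollary 5.2 of the paper: for `i, j > 0`,
`(1 − wₙ^i (wₙ*)^i)(1 − (wₙ*)^j wₙ^j) = 0 = (1 − (wₙ*)^j wₙ^j)(1 − wₙ^i (wₙ*)^i)`
for all sufficiently large `n`. -/
theorem stmt6 {F : Type*} [Field F] [Countable F]
    (f : ℕ → F[X]) (hf0 : f 0 = 1)
    (hfmem : ∀ m : ℕ, (f m).coeff 0 = 1)
    (hfenum : ∀ p : F[X], p.coeff 0 = 1 → ∃ m : ℕ, f m = p)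
    (M : ℕ → ℕ) (hM : StrictMono M) (hM1 : 1 ≤ M 1)
    (hMN : ∀ k : ℕ, 1 ≤ k → 2 * (k + 1) * Nk f k ≤ M k) :
    ∀ i j : ℕ, 0 < i → 0 < j → ∃ n₀ : ℕ, ∀ n : ℕ, n₀ ≤ n →
      (1 - (wmat F n) ^ i * (wstarmat f M n) ^ i) *
        (1 - (wstarmat f M n) ^ j * (wmat F n) ^ j) = 0 ∧
      (1 - (wstarmat f M n) ^ j * (wmat F n) ^ j) *
        (1 - (wmat F n) ^ i * (wstarmat f M n) ^ i) = 0 := by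
  intro i j _ _
  refine ⟨M 1 + 2 * (i + j) + 2, fun n hn => ?_⟩
  have hn1 : M 1 ≤ n := by omega
  have hp := Fk_coeff_zero hfmem (kidx M n)
  have hdeg := four_mul_natDegree_Fk_kidx_le hM1 hMN hn1
  rw [wstarmat_eq_correctedShift f hn1]
  exact ⟨one_sub_pow_mul_pow_mul_eq_zero fun s hs =>
      one_sub_mul_correctedShift_pow_mul_one_sub hp (by omega),
    one_sub_pow_mul_pow_mul_eq_zero fun s hs =>
      one_sub_mul_wmat_pow_mul_one_sub hp (by omega)⟩
end

section
/- Let B be the unital K-subalgebra of T = ∏_{i=1}^∞ M_i(K) generated by w, w*, and the inverses f(w)^{-1} for all f ∈ Σ. Then ⊕_{i=1}^∞ M_i(K) is an essential right ideal of B: for every nonzero x ∈ B there exists r ∈ B such that x·r ≠ 0 and x·r ∈ ⊕_{i=1}^∞ M_i(K). -/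
set_option synthInstance.maxHeartbeats 1000000
set_option maxHeartbeats 1000000

namespace ShiftProduct

/-- `T = ∏_{i=1}^∞ M_i(K)`; the index `n : ℕ` corresponds to the factor `M_{n+1}(K)`. -/
abbrev TProd (K : Type*) [Field K] : Type _ :=
  ∀ n : ℕ, Matrix (Fin (n + 1)) (Fin (n + 1)) K

/-- the element `w = (w_i)_i ∈ T`, where `w_i` is the lower shift matrix of size `i`. -/
def wT (K : Type*) [Field K] : TProd K :=
  fun n => Matrix.of fun (a b : Fin (n + 1)) => if (a : ℕ) = (b : ℕ) + 1 then (1 : K) else 0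

/-- the element `w* ∈ T`, the componentwise transpose of `w`. -/
def wstarT (K : Type*) [Field K] : TProd K :=
  fun n => (wT K n).transpose

/-- `⊕_{i=1}^∞ M_i(K)`, the ideal of sequences with finitely many nonzero components. -/
def socSet (K : Type*) [Field K] : Set (TProd K) :=
  {x | ∃ N : ℕ, ∀ n : ℕ, N ≤ n → x n = 0}

/-- the unital `K`-subalgebra of `T` generated by `w` and `w*`
(the image of the semigroup algebra `K[𝓕]` of the monogenic free inverse monoid). -/
def B0 (K : Type*) [Field K] : Subalgebra K (TProd K) :=
  Algebra.adjoin K {wT K, wstarT K}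

end ShiftProduct

namespace ShiftProduct

open Polynomial

/-- the unital `K`-subalgebra `B` of `T` generated by `w`, `w*` and the inverses
`f(w)⁻¹` for `f ∈ Σ = {f ∈ K[x] : f(0) = 1}` (these `f(w)` are units of `T`, and
`Ring.inverse` produces their inverses); `B` is the image of the universal localization
`Σ⁻¹ K[𝓕]`. -/
noncomputable def Balg (K : Type*) [Field K] : Subalgebra K (TProd K) :=
  Algebra.adjoin K ({wT K, wstarT K} ∪
    {y : TProd K | ∃ p : K[X], p.coeff 0 = 1 ∧ y = Ring.inverse (aeval (wT K) p)})

end ShiftProduct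

namespace ShiftProduct

variable {K : Type*} [Field K]

theorem wT_apply (n : ℕ) (a b : Fin (n + 1)) :
    wT K n a b = if (a : ℕ) = b + 1 then 1 else 0 := rfl

theorem wT_pow_apply (k n : ℕ) (a b : Fin (n + 1)) :
    (wT K n ^ k) a b = if (a : ℕ) = b + k then 1 else 0 := by
  induction k generalizing a with
  | zero => simp [Matrix.one_apply, Fin.ext_iff]
  | succ k ih =>
    rw [pow_succ', Matrix.mul_apply]
    simp only [ih, wT_apply, mul_ite, mul_one, mul_zero]
    split_ifs with h
    · rw [Finset.sum_eq_single ⟨b + k, by omega⟩]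
      · simp [h, add_assoc]
      · intro c _ hc
        rw [if_neg fun hck => hc (Fin.ext hck)]
      · simp
    · refine Finset.sum_eq_zero fun c _ => ?_
      split_ifs <;> first | rfl | omega

theorem wstarT_pow_apply (k n : ℕ) (a b : Fin (n + 1)) :
    (wstarT K n ^ k) a b = if (b : ℕ) = a + k then 1 else 0 := by
  rw [wstarT, ← Matrix.transpose_pow, Matrix.transpose_apply, wT_pow_apply]

theorem wT_pow_mul_wstarT_pow (p n : ℕ) :
    wT K n ^ p * wstarT K n ^ p =
      Matrix.diagonal fun a : Fin (n + 1) => if p ≤ (a : ℕ) then 1 else 0 := by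
  ext a b
  rw [Matrix.mul_apply]
  simp only [wT_pow_apply, wstarT_pow_apply, Matrix.diagonal_apply, Fin.ext_iff]
  split_ifs with hab hp
  · rw [Finset.sum_eq_single ⟨a - p, by omega⟩]
    · rw [if_pos (by simp; omega), if_pos (by simp; omega), one_mul]
    · intro c _ hc
      rw [if_neg fun h => hc (Fin.ext (by simp; omega)), zero_mul]
    · simp
  all_goals
    refine Finset.sum_eq_zero fun c _ => ?_
    split_ifs <;> first | omega | simp

theorem wstarT_mul_wT (n : ℕ) :
    wstarT K n * wT K n =
      Matrix.diagonal fun a : Fin (n + 1) => if (a : ℕ) < n then 1 else 0 := by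
  ext a b
  rw [Matrix.mul_apply]
  simp only [wstarT, Matrix.transpose_apply, wT_apply, Matrix.diagonal_apply, Fin.ext_iff]
  split_ifs with hab hp
  · rw [Finset.sum_eq_single ⟨a + 1, by omega⟩]
    · simp [hab]
    · intro c _ hc
      rw [if_neg fun h => hc (Fin.ext h), zero_mul]
    · simp
  all_goals
    refine Finset.sum_eq_zero fun c _ => ?_
    split_ifs <;> first | omega | simp

/-- The element of `T` whose only nonzero component is the last diagonal matrix unit of the
`n`-th factor. -/
def cornerUnit (K : Type*) [Field K] (n : ℕ) : TProd K :=
  (wT K ^ n * wstarT K ^ n - wT K ^ (n + 1) * wstarT K ^ (n + 1)) * (1 - wstarT K * wT K)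

theorem cornerUnit_apply (n m : ℕ) :
    cornerUnit K n m =
      Matrix.diagonal fun a : Fin (m + 1) => if (a : ℕ) = n ∧ m = n then 1 else 0 := by
  simp only [cornerUnit, Pi.mul_apply, Pi.sub_apply, Pi.pow_apply, Pi.one_apply,
    wT_pow_mul_wstarT_pow, wstarT_mul_wT]
  rw [← Matrix.diagonal_one, Matrix.diagonal_sub, Matrix.diagonal_sub, Matrix.diagonal_mul_diagonal]
  congr 1
  ext a
  have := a.2
  split_ifs <;> first | omega | simp

theorem wT_mem_Balg : wT K ∈ Balg K :=
  Algebra.subset_adjoin (by simp)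

theorem wstarT_mem_Balg : wstarT K ∈ Balg K :=
  Algebra.subset_adjoin (by simp)

theorem cornerUnit_mem_Balg (n : ℕ) : cornerUnit K n ∈ Balg K :=
  mul_mem
    (sub_mem (mul_mem (pow_mem wT_mem_Balg _) (pow_mem wstarT_mem_Balg _))
      (mul_mem (pow_mem wT_mem_Balg _) (pow_mem wstarT_mem_Balg _)))
    (sub_mem (one_mem _) (mul_mem wstarT_mem_Balg wT_mem_Balg))

theorem mul_cornerUnit_mem_socSet (x : TProd K) (n : ℕ) : x * cornerUnit K n ∈ socSet K := by
  refine ⟨n + 1, fun m hm => ?_⟩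
  simp [cornerUnit_apply, show m ≠ n by omega]

theorem mul_wstarT_pow_mul_cornerUnit_apply (x : TProd K) (n : ℕ) (i j : Fin (n + 1)) :
    (x * wstarT K ^ (n - (j : ℕ)) * cornerUnit K n) n i (Fin.last n) = x n i j := by
  simp only [Pi.mul_apply, Pi.pow_apply, cornerUnit_apply, Matrix.mul_diagonal]
  rw [Matrix.mul_apply, Finset.sum_eq_single j]
  · rw [wstarT_pow_apply, if_pos (by simp; omega)]
    simp
  · intro c _ hc
    rw [wstarT_pow_apply, if_neg fun h => hc (Fin.ext (by simp at h; omega)), mul_zero]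
  · simp

end ShiftProduct

open ShiftProduct in
/-- Proposition 4.6 of the paper (essentiality part): `⊕ M_i(K)` is an essential right
ideal of `B ≅ Σ⁻¹K[𝓕]`. -/
theorem stmt11 {K : Type*} [Field K] :
    ∀ x ∈ Balg K, x ≠ 0 → ∃ r ∈ Balg K, x * r ≠ 0 ∧ x * r ∈ socSet K := by
  intro x _ hx0
  obtain ⟨n, hn⟩ := Function.ne_iff.mp hx0
  obtain ⟨i, j, hij⟩ : ∃ i j, x n i j ≠ 0 := by
    by_contra! h
    exact hn (Matrix.ext h)
  refine ⟨wstarT K ^ (n - (j : ℕ)) * cornerUnit K n,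
    mul_mem (pow_mem wstarT_mem_Balg _) (cornerUnit_mem_Balg n), fun h => hij ?_, ?_⟩
  · rw [← mul_wstarT_pow_mul_cornerUnit_apply x n i j, mul_assoc, h]
    rfl
  · rw [← mul_assoc]
    exact mul_cornerUnit_mem_socSet _ n
end
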